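/- Let F = ℚ(x, y) be the rational function field in two variables. Then S^⧢[ I^+_{4,1}(x, y) + I^+_{4,1}(x, 1−y) + I^+_{4,1}(x, 1−1/y) − I^+_{4,1}(x, 1) ] = S^⧢[ −(1/18)Li_5((1−x)y²/(x²(1−y))) − (1/18)Li_5(x²y/((1−x)(1−y)²)) − (1/18)Li_5(x²(1−y)y/(x−1)) + (1/36)Li_5(xy²/((1−x)²(1−y))) + (1/36)Li_5((1−x)²(y−1)y/x) + (1/36)Li_5((1−x)²y/(x(1−y)²)) + (1/9)Li_5((x−1)x y²/(1−y)) + (1/9)Li_5((1−y)y/((1−x)x)) + (1/9)Li_5(y/((x−1)x(1−y)²)) − (1/2)Li_5(1/((1−x)(1−y))) − (1/2)Li_5((1−y)/(1−x)) − (1/2)Li_5(y/(1−x)) − (1/2)Li_5(−y/((1−x)(1−y))) − (1/2)Li_5((1−x)y/(y−1)) − (1/2)Li_5((1−x)y) − (5/4)Li_5(x/(1−y)) − (5/4)Li_5(x(1−y)) − (5/4)Li_5(y/x) − (5/4)Li_5(xy) − (5/4)Li_5(y/(x(y−1))) − (5/4)Li_5(xy/(y−1)) + Li_5(1/(1−x))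 + (3/2)Li_5(x) ] in V_F^{⊗5}. -/

import Mathlib

open scoped TensorProduct
open PiTensorProduct

attribute [local instance] Classical.propDecidable

set_option maxHeartbeats 1000000
set_option synthInstance.maxHeartbeats 400000

noncomputable section

namespace GrassPoly

variable (F : Type) [Field F]

/-- `V_F = F^× ⊗_ℤ ℚ` as a `ℚ`-vector space. -/
abbrev VF : Type := ℚ ⊗[ℤ] (Additive Fˣ)

variable {F}

/-- The class `[a]` of a nonzero field element in `V_F` (defined to be `0` for `a = 0`). -/
def cls (a : F) : VF F :=
  if h : a = 0 then 0 else (1 : ℚ) ⊗ₜ[ℤ] (Additive.ofMul (Units.mk0 a h))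

variable (F) in
/-- Tensor powers of V_F over ℚ. -/
abbrev TP (n : ℕ) : Type := ⨂[ℚ]^n (VF F)

instance instTPAddCommGroup (n : ℕ) : AddCommGroup (TP F n) :=
  Module.addCommMonoidToAddCommGroup ℚ

/-- Appending one extra tensor factor on the right. -/
def snoc {n : ℕ} : TP F n →ₗ[ℚ] VF F →ₗ[ℚ] TP F (n + 1) :=
  PiTensorProduct.lift
    ((PiTensorProduct.tprod ℚ (s := fun _ : Fin (n + 1) => VF F)).curryRight)

/-- The factor `t_i` appearing in the recursive definition of the symbol,
as a function of `(a_{i-1}, a_i, a_{i+1})`. -/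
def tCoef (p a q : F) : VF F :=
  if p = a then (if a = q then 0 else cls (q - a))
  else if a = q then - cls (p - a)
  else cls ((q - a) / (p - a))

/-- The symbol `S I(a₀; a₁, …, a_m; a_{m+1})`, with the middle entries given as a list
(of length `n`). -/
def SIaux : (n : ℕ) → (a0 : F) → (as : List F) → (b : F) → as.length = n → TP F n
  | 0, _, _, _, _ => tprod ℚ (fun i : Fin 0 => i.elim0)
  | n + 1, a0, as, b, h =>
      ∑ i : Fin (n + 1),
        snoc (SIaux n a0 (as.eraseIdx i.val) b
            (by
              have hi' := i.isLt
              have hi : i.val < as.length := by omega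
              have h2 := List.length_eraseIdx_of_lt hi
              omega))
          (tCoef ((a0 :: as).getD i.val 0) (as.getD i.val 0) ((as ++ [b]).getD (i.val + 1) 0))

/-- Cyclic rotation `b₁ ⊗ … ⊗ b_N ↦ b₂ ⊗ … ⊗ b_N ⊗ b₁` on tensor powers. -/
def rotN (n : ℕ) : TP F n ≃ₗ[ℚ] TP F n :=
  PiTensorProduct.reindex ℚ (fun _ : Fin n => VF F) (finRotate n).symm

/-- Splitting off the last tensor factor. -/
def splitLast (n : ℕ) : TP F (n + 1) ≃ₗ[ℚ] (TP F n) ⊗[ℚ] (VF F) :=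
  ((PiTensorProduct.reindex ℚ (fun _ : Fin (n + 1) => VF F)
      (finSumFinEquiv (m := n) (n := 1)).symm).trans
    (PiTensorProduct.tmulEquiv ℚ (VF F)).symm).trans
    (TensorProduct.congr (LinearEquiv.refl ℚ _)
      (PiTensorProduct.subsingletonEquiv (0 : Fin 1)))

/-- The projector `Π̃_N` annihilating symbols of products. -/
def Pit : (n : ℕ) → TP F n →ₗ[ℚ] TP F n
  | 0 => LinearMap.id
  | 1 => LinearMap.id
  | (n + 2) =>
      ((splitLast (n + 1)).symm.toLinearMap
        ∘ₗ TensorProduct.map (Pit (n + 1)) LinearMap.id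
        ∘ₗ (splitLast (n + 1)).toLinearMap)
      ∘ₗ ((LinearMap.id : TP F (n + 2) →ₗ[ℚ] TP F (n + 2)) - (rotN (F := F) (n + 2)).toLinearMap)

/-- The map on `V_F` induced by a field automorphism. -/
def vmap (φ : F ≃+* F) : VF F →ₗ[ℚ] VF F :=
  TensorProduct.AlgebraTensorModule.map (LinearMap.id : ℚ →ₗ[ℚ] ℚ)
    (AddMonoidHom.toIntLinearMap
      { toFun := fun a => Additive.ofMul ((Units.map (φ : F →* F)) a.toMul)
        map_zero' := by simp
        map_add' := by intro a b; simp [_root_.map_mul] })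

/-- The induced map on tensor powers. -/
def tpMap {n : ℕ} (φ : F ≃+* F) : TP F n →ₗ[ℚ] TP F n :=
  PiTensorProduct.map (fun _ => vmap φ)


/-! ### Symbols of (multiple) polylogarithms -/

/-- Symbol of `Li₂`. -/
def SLi2 (x : F) : TP F 2 := - SIaux 2 0 [x⁻¹, 0] 1 rfl

/-- Symbol of `Li₃`. -/
def SLi3 (x : F) : TP F 3 := - SIaux 3 0 [x⁻¹, 0, 0] 1 rfl

/-- Symbol of `Li₄`. -/
def SLi4 (x : F) : TP F 4 := - SIaux 4 0 [x⁻¹, 0, 0, 0] 1 rfl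

/-- Symbol of `Li₅`. -/
def SLi5 (x : F) : TP F 5 := - SIaux 5 0 [x⁻¹, 0, 0, 0, 0] 1 rfl

/-- Symbol of `I_{3,1}(x,y) = I(0; x,0,0,y; 1)`. -/
def SI31 (x y : F) : TP F 4 := SIaux 4 0 [x, 0, 0, y] 1 rfl

/-- Symbol of `I_{4,1}(x,y) = I(0; x,0,0,0,y; 1)`. -/
def SI41 (x y : F) : TP F 5 := SIaux 5 0 [x, 0, 0, 0, y] 1 rfl

/-- Symbol of `I⁺_{4,1}(x,y) = ½ (I_{4,1}(x,y) + I_{4,1}(x,y⁻¹))`. -/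
def I41p (x y : F) : TP F 5 := (2 : ℚ)⁻¹ • (SI41 x y + SI41 x y⁻¹)

/-- The anharmonic orbit of `x`, together with the signs of the
corresponding permutations in `S₃`. -/
def anhList (x : F) : List (ℚ × F) :=
  [(1, x), (1, (1 - x)⁻¹), (1, 1 - x⁻¹), (-1, x⁻¹), (-1, 1 - x), (-1, x / (x - 1))]

/-- Symbol of `Ĩ_{3,1}(x,y) = (1/36) Σ_{σ,π ∈ S₃} sgn(σ) sgn(π) I_{3,1}(x^σ, y^π)`. -/
def tI31 (x y : F) : TP F 4 :=
  (36 : ℚ)⁻¹ •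
    ((anhList x).map (fun p =>
      ((anhList y).map (fun q => (p.1 * q.1) • SI31 p.2 q.2)).sum)).sum

/-- Symbol of `Ĩ⁺_{4,1}(x,y) = (1/6) Σ_{σ ∈ S₃} sgn(σ) I⁺_{4,1}(x^σ, y)`. -/
def tI41p (x y : F) : TP F 5 :=
  (6 : ℚ)⁻¹ • ((anhList x).map (fun p => p.1 • I41p p.2 y)).sum

/-- Symbol of `V(z; x, y) = Ĩ_{3,1}(z, [x]+[y]+[(1-x)/(1-xy)]+[1-xy]+[(1-y)/(1-xy)])`. -/
def Vc (z x y : F) : TP F 4 :=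
  tI31 z x + tI31 z y + tI31 z ((1 - x) / (1 - x * y)) + tI31 z (1 - x * y)
    + tI31 z ((1 - y) / (1 - x * y))

/-- `Sym₃₆(a,b) := I_{3,1}(a,b) - Ĩ_{3,1}(a,b)` (on the level of symbols). -/
def S36 (a b : F) : TP F 4 := SI31 a b - tI31 a b

/-! ### Generic vectors -/

variable (N m : ℕ)

/-- Polynomial ring on the entries of `N` generic vectors in `m`-space. -/
abbrev Pol : Type := MvPolynomial (Fin N × Fin m) ℚ

/-- The field of rational functions in the entries of `N` generic vectors in `m`-space. -/
abbrev FF : Type := FractionRing (Pol N m)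

/-- The `j`-th coordinate of the `i`-th generic vector. -/
def gen (i : Fin N) (j : Fin m) : FF N m :=
  algebraMap (Pol N m) (FF N m) (MvPolynomial.X (i, j))

/-- `⟨i₁ … i_m⟩`: the determinant of the matrix whose columns are
the generic vectors selected by `cols`. -/
def dets (cols : Fin m → Fin N) : FF N m :=
  (Matrix.of fun r c => gen N m (cols c) r).det

/-- The field automorphism of `FF N m` induced by a permutation of the `N` vectors. -/
def permAut (σ : Equiv.Perm (Fin N)) : FF N m ≃+* FF N m :=
  IsFractionRing.ringEquivOfRingEquiv
    ((MvPolynomial.renameEquiv ℚ (σ.prodCongr (Equiv.refl (Fin m)))).toRingEquiv)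

variable {N m}

/-- Skew-symmetrization over all permutations of the `N` generic vectors. -/
def Alt {n : ℕ} (x : TP (FF N m) n) : TP (FF N m) n :=
  ∑ σ : Equiv.Perm (Fin N), (((Equiv.Perm.sign σ : ℤˣ) : ℤ) : ℚ) • tpMap (permAut N m σ) x

end GrassPoly

end

namespace GrassPoly

noncomputable section TwoVar

/-- The rational function field `ℚ(x, y)`. -/
abbrev K2 : Type := FractionRing (MvPolynomial (Fin 2) ℚ)

/-- The variable `x`. -/
def xx : K2 := algebraMap (MvPolynomial (Fin 2) ℚ) K2 (MvPolynomial.X 0)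

/-- The variable `y`. -/
def yy : K2 := algebraMap (MvPolynomial (Fin 2) ℚ) K2 (MvPolynomial.X 1)

end TwoVar

end GrassPoly

open GrassPoly


namespace GrassPoly

/-! ### Coefficient trees

Integral combinations of words in countably many letters are stored as nested lists: an entry of
`Tree (n + 1)` lists, for each possible last letter, the tree of the remaining words. -/

/-- Integral combinations of words of length `n` in letters indexed by `ℕ`. -/
abbrev Tree : ℕ → Type
  | 0 => ℤ
  | n + 1 => List (Tree n)

/-- Boolean test for the integer zero, written so that it reduces well in the kernel. -/
def isZeroInt : ℤ → Bool
  | .ofNat 0 => true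
  | _ => false

/-- Entrywise combination of two lists, where missing entries of either list are neutral. -/
def zipLong {α : Type} (f : α → α → α) : List α → List α → List α
  | [], l => l
  | a :: l, m =>
    match m with
    | [] => a :: l
    | b :: m => f a b :: zipLong f l m

namespace Tree

/-- The zero combination. -/
def zero : (n : ℕ) → Tree n
  | 0 => (0 : ℤ)
  | _ + 1 => []

/-- Addition of combinations. -/
def add : (n : ℕ) → Tree n → Tree n → Tree n
  | 0 => Int.add
  | n + 1 => zipLong (add n)

/-- Scalar multiplication of combinations. -/
def smul (c : ℤ) : (n : ℕ) → Tree n → Tree n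
  | 0, t => Int.mul c t
  | n + 1, t => cond (isZeroInt c) [] (t.map (smul c n))

/-- Appending a letter, given as an integral combination of letters. -/
def snoc (n : ℕ) (t : Tree n) (l : List ℤ) : Tree (n + 1) :=
  l.map fun c => cond (isZeroInt c) (zero n) (smul c n t)

/-- Sum of a family indexed by `Fin k`. -/
def sumFin (n : ℕ) : (k : ℕ) → (Fin k → Tree n) → Tree n
  | 0, _ => zero n
  | k + 1, f => add n (f 0) (sumFin n k fun i => f i.succ)

/-- Sum of a list of combinations with integral weights. -/
def weightedSum (n : ℕ) : List (ℤ × Tree n) → Tree n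
  | [] => zero n
  | p :: l => add n (smul p.1 n p.2) (weightedSum n l)

/-- Adjoin a row to a transposed matrix of combinations. -/
def consRow (n : ℕ) : List (Tree n) → List (List (Tree n)) → List (List (Tree n))
  | [], cols => cols.map fun c => zero n :: c
  | a :: row, cols =>
    match cols with
    | [] => [a] :: consRow n row []
    | c :: cols => (a :: c) :: consRow n row cols

/-- Exchange of the last two letters. -/
def transpose (n : ℕ) : List (List (Tree n)) → List (List (Tree n))
  | [] => []
  | row :: rows => consRow n row (transpose n rows)

/-- Cyclic rotation moving the first letter to the end. -/
def rot : (n : ℕ) → Tree (n + 1) → Tree (n + 1)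
  | 0, t => t
  | n + 1, t => transpose n (t.map (rot n))

/-- The projector `Pit` on combinations of words. -/
def proj : (n : ℕ) → Tree n → Tree n
  | 0, t => t
  | 1, t => t
  | n + 2, t => (add (n + 2) t (smul (-1) (n + 2) (rot (n + 1) t))).map (proj (n + 1))

/-- Boolean test for all coefficients being zero. -/
def isZero : (n : ℕ) → Tree n → Bool
  | 0, t => isZeroInt t
  | n + 1, t => t.all (isZero n)

/-- The symbol of an iterated integral whose points carry labels in `Fin k`, where `d i j` is the
vector of exponents of the difference of the points labelled `i` and `j`. -/
def symbol {k : ℕ} [NeZero k] (d : Fin k → Fin k → List ℤ) (b : Fin k) (a0 : Fin k) :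
    (n : ℕ) → List (Fin k) → Tree n
  | 0, _ => (1 : ℤ)
  | n + 1, as =>
    sumFin (n + 1) (n + 1) fun i =>
      snoc n (symbol d b a0 n (as.eraseIdx i.val))
        (zipLong Int.add
          (d ((as ++ [b]).getD (i.val + 1) 0) (as.getD i.val 0))
          ((d ((a0 :: as).getD i.val 0) (as.getD i.val 0)).map Int.neg))

end Tree

/-- The symmetric table of exponent vectors of the differences of `0, 1, p, q`. -/
def diffTable (p p' q q' r : List ℤ) (i j : Fin 4) : List ℤ :=
  ![![[], [], p, q], ![[], [], p', q'], ![p, p', [], r], ![q, q', r, []]] i j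

/-- The symbol of `I_{4,1}(x, y)` in terms of the exponent vectors of `y`, `1 - y` and `x - y`. -/
def i41Tree (u v w : List ℤ) : Tree 5 :=
  Tree.symbol (diffTable [1] [0, 1] u v w) 1 0 5 [2, 0, 0, 0, 3]

/-- Minus the symbol of `Li₅(z)` in terms of the exponent vectors of `z` and `1 - z`. -/
def li5Tree (u v : List ℤ) : Tree 5 :=
  Tree.symbol (diffTable (u.map Int.neg) (zipLong Int.add v (u.map Int.neg))
    (u.map Int.neg) (zipLong Int.add v (u.map Int.neg)) []) 1 0 5
    [2, 0, 0, 0, 0]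

/-- The difference of the two sides of the three-term identity, multiplied by `36`. -/
def threeTermTree : Tree 5 :=
  Tree.weightedSum 5
   [(18, i41Tree [0, 0, 1] [0, 0, 0, 1] [0, 0, 0, 0, 1]),
    (18, i41Tree [0, 0, -1] [0, 0, -1, 1] [0, 0, -1, 0, 0, 1]),
    (18, i41Tree [0, 0, 0, 1] [0, 0, 1] [0, 0, 0, 0, 0, 0, 1]),
    (18, i41Tree [0, 0, 0, -1] [0, 0, 1, -1] [0, 0, 0, -1, 0, 0, 0, 1]),
    (18, i41Tree [0, 0, -1, 1] [0, 0, -1] [0, 0, -1, 0, 0, 0, 0, 0, 1]),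
    (18, i41Tree [0, 0, 1, -1] [0, 0, 0, -1] [0, 0, 0, -1, 0, 0, 0, 0, 0, 1]),
    (-36, i41Tree [] [] [0, 1]),
    (-2, li5Tree [-2, 1, 2, -1] [-2, 0, 0, -1, 1, 0, 0, 0, 0, 1]),
    (-2, li5Tree [2, -1, 1, -2] [0, -1, 0, -2, 0, 0, 1, 0, 1]),
    (-2, li5Tree [2, -1, 1, 1] [0, -1, 0, 0, 0, 1, 0, 1]),
    (1, li5Tree [1, -2, 2, -1] [0, -2, 0, -1, 0, 0, 1, 1]),
    (1, li5Tree [-1, 2, 1, 1] [-1, 0, 0, 0, 0, 0, 0, 0, 1, 1]),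
    (1, li5Tree [-1, 2, 1, -2] [-1, 0, 0, -2, 1, 1]),
    (4, li5Tree [1, 1, 2, -1] [0, 0, 0, -1, 0, 1, 0, 0, 1]),
    (4, li5Tree [-1, -1, 1, 1] [-1, -1, 0, 0, 1, 0, 1]),
    (4, li5Tree [-1, -1, 1, -2] [-1, -1, 0, -2, 0, 0, 0, 1, 0, 1]),
    (-18, li5Tree [0, -1, 0, -1] [0, -1, 0, -1, 0, 0, 0, 0, 0, 1]),
    (-18, li5Tree [0, -1, 0, 1] [0, -1, 0, 0, 1]),
    (-18, li5Tree [0, -1, 1] [0, -1, 0, 0, 0, 0, 1]),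
    (-18, li5Tree [0, -1, 1, -1] [0, -1, 0, -1, 0, 0, 0, 1]),
    (-18, li5Tree [0, 1, 1, -1] [0, 0, 0, -1, 0, 1]),
    (-18, li5Tree [0, 1, 1] [0, 0, 0, 0, 0, 0, 0, 0, 1]),
    (-45, li5Tree [1, 0, 0, -1] [0, 0, 0, -1, 0, 0, 1]),
    (-45, li5Tree [1, 0, 0, 1] [0, 0, 0, 0, 0, 0, 0, 1]),
    (-45, li5Tree [-1, 0, 1] [-1, 0, 0, 0, 1]),
    (-45, li5Tree [1, 0, 1] [0, 0, 0, 0, 0, 1]),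
    (-45, li5Tree [-1, 0, 1, -1] [-1, 0, 0, -1, 0, 0, 0, 0, 0, 1]),
    (-45, li5Tree [1, 0, 1, -1] [0, 0, 0, -1, 0, 0, 0, 0, 1]),
    (36, li5Tree [0, -1] [1, -1]),
    (54, li5Tree [1] [0, 1])]

/-- Decidability of Boolean truth that reduces in the kernel. -/
local instance (priority := high) decidableBoolTrue (b : Bool) : Decidable (b = true) :=
  instDecidableEqBool b true

theorem isZero_proj_threeTermTree : (Tree.proj 5 threeTermTree).isZero 5 = true := by
  decide +kernel


/-! ### Evaluation of coefficient trees -/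

section Evaluation

variable {α M N : Type} [AddCommMonoid M] [AddCommMonoid N]

/-- The sum of a function of position and entry over a list. -/
def lsum (f : ℕ → α → M) : List α → M
  | [] => 0
  | a :: l => f 0 a + lsum (fun i => f (i + 1)) l
termination_by structural l => l

theorem lsum_map {β : Type} (g : β → α) (f : ℕ → α → M) (l : List β) :
    lsum f (l.map g) = lsum (fun i b => f i (g b)) l := by
  induction l generalizing f with
  | nil => rfl
  | cons a l ih => simp only [List.map_cons, lsum, ih]

theorem lsum_hom (φ : M →+ N) (f : ℕ → α → M) (l : List α) :
    φ (lsum f l) = lsum (fun i a => φ (f i a)) l := by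
  induction l generalizing f with
  | nil => simp [lsum]
  | cons a l ih => simp only [lsum, map_add, ih]

theorem lsum_congr {f g : ℕ → α → M} {l : List α} (h : ∀ i, ∀ a ∈ l, f i a = g i a) :
    lsum f l = lsum g l := by
  induction l generalizing f g with
  | nil => rfl
  | cons a l ih =>
    simp only [lsum]
    rw [h 0 a (by simp), ih fun i b hb => h (i + 1) b (by simp [hb])]

theorem lsum_eq_zero {f : ℕ → α → M} {l : List α} (h : ∀ i, ∀ a ∈ l, f i a = 0) :
    lsum f l = 0 := by
  induction l generalizing f with
  | nil => rfl
  | cons a l ih =>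
    simp only [lsum]
    rw [h 0 a (by simp), ih fun i b hb => h (i + 1) b (by simp [hb]), add_zero]

theorem lsum_zipLong (op : α → α → α) (f : ℕ → α → M)
    (h : ∀ i a b, f i (op a b) = f i a + f i b) (l m : List α) :
    lsum f (zipLong op l m) = lsum f l + lsum f m := by
  induction l generalizing f m with
  | nil => simp [zipLong, lsum]
  | cons a l ih =>
    cases m with
    | nil => simp [zipLong, lsum]
    | cons b m =>
      simp only [zipLong, lsum, h, ih _ fun i => h (i + 1)]
      abel

theorem lsum_consRow (n : ℕ) (f : ℕ → ℕ → Tree n → M) (h : ∀ i j, f i j (Tree.zero n) = 0)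
    (row : List (Tree n)) (cols : List (List (Tree n))) :
    lsum (fun j c => lsum (fun i t => f i j t) c) (Tree.consRow n row cols) =
      lsum (fun j t => f 0 j t) row + lsum (fun j c => lsum (fun i t => f (i + 1) j t) c) cols := by
  induction row generalizing f cols with
  | nil => simp [Tree.consRow, lsum_map, lsum, h]
  | cons a row ih =>
    cases cols with
    | nil =>
      simp only [Tree.consRow, lsum]
      rw [ih (fun i j => f i (j + 1)) fun i j => h i (j + 1)]
      simp [lsum]
    | cons c cols =>
      simp only [Tree.consRow, lsum]
      rw [ih (fun i j => f i (j + 1)) fun i j => h i (j + 1)]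
      abel

theorem lsum_transpose (n : ℕ) (f : ℕ → ℕ → Tree n → M) (h : ∀ i j, f i j (Tree.zero n) = 0)
    (L : List (List (Tree n))) :
    lsum (fun j c => lsum (fun i t => f i j t) c) (Tree.transpose n L) =
      lsum (fun i r => lsum (fun j t => f i j t) r) L := by
  induction L generalizing f with
  | nil => rfl
  | cons r L ih =>
    rw [Tree.transpose, lsum_consRow n f h, ih (fun i j => f (i + 1) j) fun i j => h (i + 1) j,
      lsum]

end Evaluation

theorem isZeroInt_iff (c : ℤ) : isZeroInt c = true ↔ c = 0 := by
  match c with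
  | .ofNat 0 => exact ⟨fun _ => rfl, fun _ => rfl⟩
  | .ofNat (k + 1) => exact ⟨(fun h => by cases h), (fun h => by cases h)⟩
  | .negSucc k => exact ⟨(fun h => by cases h), (fun h => by cases h)⟩

section Tensor

variable {F : Type} [Field F]

/-- The integral combination of the vectors `v i` with the given coefficients. -/
def lin (v : ℕ → VF F) (l : List ℤ) : VF F := lsum (fun i (c : ℤ) => (c : ℚ) • v i) l

/-- The tensor with the given coefficient tree in the letters `v i`. -/
def eval (v : ℕ → VF F) : (n : ℕ) → Tree n → TP F n
  | 0, c => ((show ℤ from c) : ℚ) • PiTensorProduct.tprod ℚ (fun i : Fin 0 => i.elim0)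
  | n + 1, t => lsum (fun i s => snoc (eval v n s) (v i)) t

theorem lin_zipLong (v : ℕ → VF F) (l m : List ℤ) :
    lin v (zipLong Int.add l m) = lin v l + lin v m :=
  lsum_zipLong _ _ (fun i a b => by
    change ((a + b : ℤ) : ℚ) • v i = _
    rw [Int.cast_add, add_smul]) _ _

theorem lin_neg (v : ℕ → VF F) (l : List ℤ) : lin v (l.map Int.neg) = - lin v l := by
  rw [lin, lsum_map, lin]
  have := lsum_hom (-AddMonoidHom.id (VF F)) (fun i (c : ℤ) => (c : ℚ) • v i) l
  simp only [AddMonoidHom.neg_apply, AddMonoidHom.id_apply] at this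
  rw [this]
  exact lsum_congr fun i c _ => by
    change ((-c : ℤ) : ℚ) • v i = _
    rw [Int.cast_neg, neg_smul]

theorem eval_zero (v : ℕ → VF F) (n : ℕ) : eval v n (Tree.zero n) = 0 := by
  cases n with
  | zero => simp [eval, Tree.zero]
  | succ n => rfl

theorem eval_add (v : ℕ → VF F) (n : ℕ) (s t : Tree n) :
    eval v n (Tree.add n s t) = eval v n s + eval v n t := by
  induction n with
  | zero =>
    change (((s + t : ℤ)) : ℚ) • _ = _
    rw [Int.cast_add, add_smul]
    rfl
  | succ n ih =>
    exact lsum_zipLong _ _ (fun i a b => by rw [ih, map_add, LinearMap.add_apply]) _ _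

theorem eval_smul (v : ℕ → VF F) (c : ℤ) (n : ℕ) (t : Tree n) :
    eval v n (Tree.smul c n t) = (c : ℚ) • eval v n t := by
  induction n with
  | zero =>
    change (((c * t : ℤ)) : ℚ) • _ = _
    rw [Int.cast_mul, mul_smul]
    rfl
  | succ n ih =>
    cases hc : isZeroInt c with
    | true =>
      simp only [Tree.smul, hc, cond_true]
      rw [(isZeroInt_iff c).1 hc, Int.cast_zero, zero_smul]
      rfl
    | false =>
      simp only [Tree.smul, hc, cond_false, eval]
      rw [lsum_map]
      have := lsum_hom (DistribSMul.toAddMonoidHom (TP F (n + 1)) (c : ℚ))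
        (fun i s => snoc (eval v n s) (v i)) t
      simp only [DistribSMul.toAddMonoidHom_apply] at this
      rw [this]
      exact lsum_congr fun i s _ => by rw [ih, map_smul, LinearMap.smul_apply]

theorem eval_snoc (v : ℕ → VF F) (n : ℕ) (t : Tree n) (l : List ℤ) :
    eval v (n + 1) (Tree.snoc n t l) = snoc (eval v n t) (lin v l) := by
  simp only [eval, Tree.snoc, lin]
  have := lsum_hom (snoc (eval v n t)).toAddMonoidHom (fun i (c : ℤ) => (c : ℚ) • v i) l
  simp only [LinearMap.toAddMonoidHom_coe] at this
  rw [this, lsum_map]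
  refine lsum_congr fun i c _ => ?_
  rw [map_smul]
  cases hc : isZeroInt c with
  | true =>
    rw [cond_true, eval_zero, (isZeroInt_iff c).1 hc, Int.cast_zero, zero_smul, map_zero,
      LinearMap.zero_apply]
  | false => rw [cond_false, eval_smul, map_smul, LinearMap.smul_apply]

theorem eval_sumFin (v : ℕ → VF F) (n k : ℕ) (f : Fin k → Tree n) :
    eval v n (Tree.sumFin n k f) = ∑ i, eval v n (f i) := by
  induction k with
  | zero => simp [Tree.sumFin, eval_zero]
  | succ k ih => rw [Tree.sumFin, eval_add, ih, Fin.sum_univ_succ]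

theorem eval_weightedSum (v : ℕ → VF F) (n : ℕ) (l : List (ℤ × Tree n)) :
    eval v n (Tree.weightedSum n l) = (l.map fun p => (p.1 : ℚ) • eval v n p.2).sum := by
  induction l with
  | nil => simp [Tree.weightedSum, eval_zero]
  | cons p l ih => rw [Tree.weightedSum, eval_add, eval_smul, ih, List.map_cons, List.sum_cons]

theorem eval_eq_zero_of_isZero (v : ℕ → VF F) (n : ℕ) (t : Tree n) (h : t.isZero n = true) :
    eval v n t = 0 := by
  induction n with
  | zero =>
    have ht : (show ℤ from t) = 0 := (isZeroInt_iff t).1 h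
    rw [eval, ht, Int.cast_zero, zero_smul]
  | succ n ih =>
    refine lsum_eq_zero fun i s hs => ?_
    rw [ih s (List.all_eq_true.1 h s hs), map_zero, LinearMap.zero_apply]

/-! ### Rotation and the projector on evaluated trees -/

theorem snoc_tprod {n : ℕ} (f : Fin n → VF F) (a : VF F) :
    snoc (tprod ℚ f) a = tprod ℚ (Fin.snoc (α := fun _ => VF F) f a) := by
  rw [snoc, PiTensorProduct.lift.tprod]
  rfl

theorem rotN_tprod (n : ℕ) (f : Fin n → VF F) :
    rotN n (tprod ℚ f) = tprod ℚ (fun i => f (finRotate n i)) := by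
  rw [rotN, PiTensorProduct.reindex_tprod]
  rfl

theorem rotN_one (t : TP F 1) : rotN 1 t = t := by
  induction t using PiTensorProduct.induction_on with
  | smul_tprod r f =>
    rw [map_smul, rotN_tprod]
    congr 3
    funext i
    rw [Subsingleton.elim (finRotate 1 i) i]
  | add x y hx hy => rw [map_add, hx, hy]

/-- Prepending a tensor factor commutes with appending one. -/
theorem rotN_snoc_rotN_symm_snoc {n : ℕ} (t : TP F n) (a b : VF F) :
    rotN (n + 2) (snoc ((rotN (n + 1)).symm (snoc t b)) a) = snoc (snoc t a) b := by
  induction t using PiTensorProduct.induction_on with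
  | smul_tprod r f =>
    simp only [map_smul, LinearMap.smul_apply]
    have h : (rotN (n + 1)).symm (snoc (tprod ℚ f) b) =
        tprod ℚ (Fin.cons (α := fun _ => VF F) b f) := by
      rw [LinearEquiv.symm_apply_eq, rotN_tprod, snoc_tprod, Fin.snoc_eq_cons_rotate]
    rw [h, snoc_tprod, snoc_tprod, snoc_tprod, rotN_tprod, Fin.snoc_eq_cons_rotate _ b,
      Fin.cons_snoc_eq_snoc_cons]
  | add x y hx hy => simp only [map_add, LinearMap.add_apply, hx, hy]

theorem splitLast_snoc {n : ℕ} (t : TP F n) (a : VF F) :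
    splitLast n (snoc t a) = t ⊗ₜ[ℚ] a := by
  induction t using PiTensorProduct.induction_on with
  | smul_tprod r f =>
    rw [map_smul, LinearMap.smul_apply, map_smul, snoc_tprod, splitLast]
    simp only [LinearEquiv.trans_apply]
    rw [PiTensorProduct.reindex_tprod, PiTensorProduct.tmulEquiv_symm_apply,
      TensorProduct.congr_tmul, PiTensorProduct.subsingletonEquiv_apply_tprod,
      TensorProduct.smul_tmul']
    congr 2
    · simp [Fin.snoc]
    · simp [Fin.snoc]
  | add x y hx hy => simp only [map_add, LinearMap.add_apply, hx, hy, TensorProduct.add_tmul]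

theorem eval_rot (v : ℕ → VF F) (n : ℕ) (t : Tree (n + 1)) :
    eval v (n + 1) (Tree.rot n t) = rotN (n + 1) (eval v (n + 1) t) := by
  induction n with
  | zero => rw [Tree.rot, rotN_one]
  | succ n ih =>
    have key : ∀ (i : ℕ) (s : Tree (n + 1)),
        rotN (n + 2) (snoc (eval v (n + 1) s) (v i)) =
          lsum (fun j r => snoc (snoc (eval v n r) (v i)) (v j)) (Tree.rot n s) := by
      intro i s
      have h1 : eval v (n + 1) s = (rotN (n + 1)).symm (eval v (n + 1) (Tree.rot n s)) := by
        rw [ih, LinearEquiv.symm_apply_apply]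
      have h2 := lsum_hom
        (((rotN (n + 2)).toLinearMap ∘ₗ (snoc (F := F) (n := n + 1)).flip (v i) ∘ₗ
          (rotN (n + 1)).symm.toLinearMap).toAddMonoidHom)
        (fun j r => snoc (eval v n r) (v j)) (Tree.rot n s)
      simp only [LinearMap.toAddMonoidHom_coe, LinearMap.comp_apply, LinearEquiv.coe_coe,
        LinearMap.flip_apply, rotN_snoc_rotN_symm_snoc] at h2
      rw [h1]
      exact h2
    have h3 := lsum_hom (rotN (F := F) (n + 2)).toLinearMap.toAddMonoidHom
      (fun i s => snoc (eval v (n + 1) s) (v i)) t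
    simp only [LinearMap.toAddMonoidHom_coe, LinearEquiv.coe_coe, key] at h3
    refine Eq.trans ?_ h3.symm
    have h4 := lsum_transpose n (fun i j r => snoc (snoc (eval v n r) (v i)) (v j))
      (fun i j => by simp [eval_zero]) (t.map (Tree.rot n))
    rw [lsum_map] at h4
    refine Eq.trans ?_ h4
    refine lsum_congr fun j c _ => ?_
    have h5 := lsum_hom ((snoc (F := F) (n := n + 1)).flip (v j)).toAddMonoidHom
      (fun i r => snoc (eval v n r) (v i)) c
    exact h5

theorem Pit_succ_succ_apply (n : ℕ) (t : TP F (n + 2)) :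
    Pit (n + 2) t = (splitLast (n + 1)).symm
      (TensorProduct.map (Pit (n + 1)) LinearMap.id (splitLast (n + 1) (t - rotN (n + 2) t))) :=
  rfl

theorem eval_proj (v : ℕ → VF F) (n : ℕ) (t : Tree n) :
    eval v n (Tree.proj n t) = Pit n (eval v n t) := by
  induction n using Nat.strong_induction_on with
  | _ n ih =>
    match n, t, ih with
    | 0, _, _ => rfl
    | 1, _, _ => rfl
    | n + 2, t, ih =>
      have h : eval v (n + 2) t - rotN (n + 2) (eval v (n + 2) t) =
          eval v (n + 2) (Tree.add (n + 2) t (Tree.smul (-1) (n + 2) (Tree.rot (n + 1) t))) := by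
        rw [eval_add, eval_smul, eval_rot]
        simp [sub_eq_add_neg]
      rw [Pit_succ_succ_apply, h]
      have h1 := lsum_hom
        ((splitLast (n + 1)).symm.toLinearMap ∘ₗ
          TensorProduct.map (Pit (n + 1)) LinearMap.id ∘ₗ
            (splitLast (F := F) (n + 1)).toLinearMap).toAddMonoidHom
        (fun i r => snoc (eval v (n + 1) r) (v i))
        (Tree.add (n + 2) t (Tree.smul (-1) (n + 2) (Tree.rot (n + 1) t)))
      simp only [LinearMap.toAddMonoidHom_coe, LinearMap.comp_apply, LinearEquiv.coe_coe,
        splitLast_snoc, TensorProduct.map_tmul, LinearMap.id_apply] at h1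
      refine Eq.trans ?_ h1.symm
      rw [eval, Tree.proj, lsum_map]
      refine lsum_congr (M := TP F (n + 2)) fun i r _ => ?_
      rw [ih (n + 1) (by omega), LinearEquiv.eq_symm_apply, splitLast_snoc]

end Tensor


/-! ### Symbols as evaluated trees -/

section Symbol

variable {F : Type} [Field F]

theorem cls_units (u : Fˣ) : cls (u : F) = (1 : ℚ) ⊗ₜ[ℤ] Additive.ofMul u := by
  rw [cls, dif_neg u.ne_zero, Units.mk0_val]

theorem cls_mul {a b : F} (ha : a ≠ 0) (hb : b ≠ 0) : cls (a * b) = cls a + cls b := by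
  lift a to Fˣ using ha.isUnit
  lift b to Fˣ using hb.isUnit
  rw [← Units.val_mul, cls_units, cls_units, cls_units, ofMul_mul, TensorProduct.tmul_add]

theorem cls_zero : cls (0 : F) = 0 := dif_pos rfl

theorem cls_one : cls (1 : F) = 0 := by
  rw [← Units.val_one, cls_units, ofMul_one, TensorProduct.tmul_zero]

theorem cls_neg_one : cls (-1 : F) = 0 := by
  have h : cls (-1 : F) + cls (-1) = 0 := by
    rw [← cls_mul (neg_ne_zero.2 one_ne_zero) (neg_ne_zero.2 one_ne_zero), neg_mul_neg, one_mul,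
      cls_one]
  rw [← two_smul ℚ] at h
  exact (smul_eq_zero.1 h).resolve_left two_ne_zero

theorem cls_neg (a : F) : cls (-a) = cls a := by
  by_cases ha : a = 0
  · rw [ha, neg_zero]
  · rw [← neg_one_mul, cls_mul (neg_ne_zero.2 one_ne_zero) ha, cls_neg_one, zero_add]

theorem cls_sub_comm (a b : F) : cls (a - b) = cls (b - a) := by
  rw [← neg_sub, cls_neg]

theorem cls_inv (a : F) : cls a⁻¹ = - cls a := by
  by_cases ha : a = 0
  · rw [ha, inv_zero, cls_zero, neg_zero]
  · rw [eq_neg_iff_add_eq_zero, ← cls_mul (inv_ne_zero ha) ha, inv_mul_cancel₀ ha, cls_one]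

theorem cls_div {a b : F} (ha : a ≠ 0) (hb : b ≠ 0) : cls (a / b) = cls a - cls b := by
  rw [div_eq_mul_inv, cls_mul ha (inv_ne_zero hb), cls_inv, sub_eq_add_neg]

theorem cls_zpow {a : F} (ha : a ≠ 0) (c : ℤ) : cls (a ^ c) = (c : ℚ) • cls a := by
  lift a to Fˣ using ha.isUnit
  rw [← Units.val_zpow_eq_zpow_val, cls_units, cls_units, ofMul_zpow, Int.cast_smul_eq_zsmul]
  exact map_zsmul (TensorProduct.mk ℤ ℚ (Additive Fˣ) 1).toAddMonoidHom c _

/-- The monomial in the `g i` with the given exponents. -/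
def monomial (g : ℕ → F) : List ℤ → F
  | [] => 1
  | c :: l => g 0 ^ c * monomial (fun i => g (i + 1)) l
termination_by structural l => l

theorem monomial_ne_zero {g : ℕ → F} (hg : ∀ i, g i ≠ 0) (l : List ℤ) : monomial g l ≠ 0 := by
  induction l generalizing g with
  | nil => exact one_ne_zero
  | cons c l ih => exact mul_ne_zero (zpow_ne_zero c (hg 0)) (ih fun i => hg (i + 1))

theorem cls_monomial {g : ℕ → F} (hg : ∀ i, g i ≠ 0) (l : List ℤ) :
    cls (monomial g l) = lin (fun i => cls (g i)) l := by
  induction l generalizing g with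
  | nil => exact cls_one
  | cons c l ih =>
    rw [monomial, cls_mul (zpow_ne_zero c (hg 0)) (monomial_ne_zero (fun i => hg (i + 1)) l),
      cls_zpow (hg 0), ih fun i => hg (i + 1)]
    rfl

theorem cls_eq_lin {g : ℕ → F} (hg : ∀ i, g i ≠ 0) {a : F} {l : List ℤ}
    (h : a = monomial g l ∨ a = -monomial g l) : cls a = lin (fun i => cls (g i)) l := by
  rcases h with rfl | rfl
  · exact cls_monomial hg l
  · rw [cls_neg, cls_monomial hg l]

theorem tCoef_eq (p a q : F) : tCoef p a q = cls (q - a) - cls (p - a) := by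
  unfold tCoef
  split_ifs with h1 h2 h2
  · subst h1 h2
    simp [cls_zero]
  · simp [h1, cls_zero]
  · simp [h2, cls_zero]
  · exact cls_div (sub_ne_zero.2 (Ne.symm h2)) (sub_ne_zero.2 h1)

theorem eval_symbol {k : ℕ} [NeZero k] {v : ℕ → VF F} {d : Fin k → Fin k → List ℤ}
    {pt : Fin k → F} (h0 : pt 0 = 0) (hd : ∀ i j, cls (pt i - pt j) = lin v (d i j))
    (b a0 : Fin k) (n : ℕ) (as : List (Fin k)) (as' : List F) (has : as' = as.map pt)
    (hn : as'.length = n) :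
    SIaux n (pt a0) as' (pt b) hn = eval v n (Tree.symbol d b a0 n as) := by
  induction n generalizing as as' with
  | zero => simp [SIaux, Tree.symbol, eval]
  | succ n ih =>
    subst has
    rw [SIaux, Tree.symbol, eval_sumFin]
    refine Finset.sum_congr rfl fun i _ => ?_
    rw [eval_snoc, lin_zipLong, lin_neg, ← hd, ← hd, tCoef_eq,
      ih (as.eraseIdx i) _ (List.eraseIdx_map ..), sub_eq_add_neg]
    have hget : ∀ (l : List (Fin k)) (j : ℕ), (l.map pt).getD j 0 = pt (l.getD j 0) := by
      intro l j
      rw [← h0, List.getD_map]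
    have hb : as.map pt ++ [pt b] = (as ++ [b]).map pt := by simp
    rw [hb, ← List.map_cons, hget, hget, hget]

theorem lin_nil (v : ℕ → VF F) : lin v [] = 0 := rfl

theorem cls_sub_eq_lin_diffTable {v : ℕ → VF F} {p q : F} {u u' w w' r : List ℤ}
    (hp : cls p = lin v u) (hp' : cls (1 - p) = lin v u') (hq : cls q = lin v w)
    (hq' : cls (1 - q) = lin v w') (hr : cls (p - q) = lin v r) (i j : Fin 4) :
    cls (![0, 1, p, q] i - ![0, 1, p, q] j) = lin v (diffTable u u' w w' r i j) := by
  have hp'' := cls_sub_comm p 1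
  have hq'' := cls_sub_comm q 1
  have hr'' := cls_sub_comm q p
  fin_cases i <;> fin_cases j <;>
    simp [diffTable, lin_nil, cls_zero, cls_one, cls_neg, hp, hp', hq, hq', hr, hp'', hq'', hr'']

theorem SI41_eq_eval {v : ℕ → VF F} {x y : F} {s t w : List ℤ} (hx : cls x = lin v [1])
    (hx' : cls (1 - x) = lin v [0, 1]) (hy : cls y = lin v s) (hy' : cls (1 - y) = lin v t)
    (hxy : cls (x - y) = lin v w) : SI41 x y = eval v 5 (i41Tree s t w) :=
  eval_symbol (pt := ![0, 1, x, y]) rfl (cls_sub_eq_lin_diffTable hx hx' hy hy' hxy) 1 0 5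
    [2, 0, 0, 0, 3] _ rfl rfl

theorem SLi5_eq_eval {v : ℕ → VF F} {z : F} {s t : List ℤ} (hz0 : z ≠ 0) (hz1 : 1 - z ≠ 0)
    (hz : cls z = lin v s) (hz' : cls (1 - z) = lin v t) :
    SLi5 z = - eval v 5 (li5Tree s t) := by
  have h : cls z⁻¹ = lin v (s.map Int.neg) := by rw [cls_inv, hz, lin_neg]
  have h' : cls (1 - z⁻¹) = lin v (zipLong Int.add t (s.map Int.neg)) := by
    have e : 1 - z⁻¹ = -((1 - z) / z) := by
      field_simp
      ring
    rw [e, cls_neg, cls_div hz1 hz0, lin_zipLong, lin_neg, hz, hz', sub_eq_add_neg]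
  have hd := cls_sub_eq_lin_diffTable (q := z⁻¹) h h' h h' (by rw [sub_self, cls_zero, lin_nil])
  have key : SIaux 5 0 [z⁻¹, 0, 0, 0, 0] 1 rfl = eval v 5 (li5Tree s t) :=
    eval_symbol (pt := ![0, 1, z⁻¹, z⁻¹]) rfl hd 1 0 5 [2, 0, 0, 0, 0] _ rfl rfl
  rw [SLi5, key]

end Symbol

/-! ### The three-term identity -/

/-- The irreducible polynomials in `x, y` that occur in the three-term identity. -/
noncomputable def letter : ℕ → K2
  | 0 => xx
  | 1 => 1 - xx
  | 2 => yy
  | 3 => 1 - yy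
  | 4 => xx - yy
  | 5 => 1 - xx * yy
  | 6 => xx - 1 + yy
  | 7 => 1 - xx * (1 - yy)
  | 8 => 1 - yy + xx * yy
  | 9 => xx + yy - xx * yy
  | _ => 1

theorem algebraMap_K2_ne_zero {p : MvPolynomial (Fin 2) ℚ}
    (h : MvPolynomial.eval ![3, 5] p ≠ 0) : algebraMap (MvPolynomial (Fin 2) ℚ) K2 p ≠ 0 := by
  intro h0
  rw [IsFractionRing.to_map_eq_zero_iff] at h0
  exact h (by rw [h0, map_zero])

theorem letter_ne_zero (i : ℕ) : letter i ≠ 0 := by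
  have key : ∀ p : MvPolynomial (Fin 2) ℚ, MvPolynomial.eval ![3, 5] p ≠ 0 →
      ∀ a : K2, algebraMap _ K2 p = a → a ≠ 0 := fun p hp a ha => ha ▸ algebraMap_K2_ne_zero hp
  let X : MvPolynomial (Fin 2) ℚ := MvPolynomial.X 0
  let Y : MvPolynomial (Fin 2) ℚ := MvPolynomial.X 1
  match i with
  | 0 => exact key X (by simp [X]) _ (by simp [X, letter, xx])
  | 1 => exact key (1 - X) (by norm_num [X]) _ (by simp [X, letter, xx])
  | 2 => exact key Y (by simp [Y]) _ (by simp [Y, letter, yy])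
  | 3 => exact key (1 - Y) (by norm_num [Y]) _ (by simp [Y, letter, yy])
  | 4 => exact key (X - Y) (by norm_num [X, Y]) _ (by simp [X, Y, letter, xx, yy])
  | 5 => exact key (1 - X * Y) (by norm_num [X, Y]) _ (by simp [X, Y, letter, xx, yy])
  | 6 => exact key (X - 1 + Y) (by norm_num [X, Y]) _ (by simp [X, Y, letter, xx, yy])
  | 7 => exact key (1 - X * (1 - Y)) (by norm_num [X, Y]) _ (by simp [X, Y, letter, xx, yy])
  | 8 => exact key (1 - Y + X * Y) (by norm_num [X, Y]) _ (by simp [X, Y, letter, xx, yy])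
  | 9 => exact key (X + Y - X * Y) (by norm_num [X, Y]) _ (by simp [X, Y, letter, xx, yy])
  | _ + 10 => exact one_ne_zero

theorem SI41_eq_eval_letter {y : K2} (s t w : List ℤ)
    (hy : y = monomial letter s ∨ y = -monomial letter s)
    (hy' : 1 - y = monomial letter t ∨ 1 - y = -monomial letter t)
    (hxy : xx - y = monomial letter w ∨ xx - y = -monomial letter w) :
    SI41 xx y = eval (fun i => cls (letter i)) 5 (i41Tree s t w) :=
  SI41_eq_eval (cls_eq_lin letter_ne_zero (.inl (by simp [monomial, letter])))
    (cls_eq_lin letter_ne_zero (.inl (by simp [monomial, letter])))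
    (cls_eq_lin letter_ne_zero hy) (cls_eq_lin letter_ne_zero hy') (cls_eq_lin letter_ne_zero hxy)

theorem SLi5_eq_eval_letter {z : K2} (s t : List ℤ)
    (hz : z = monomial letter s ∨ z = -monomial letter s)
    (hz' : 1 - z = monomial letter t ∨ 1 - z = -monomial letter t) :
    SLi5 z = - eval (fun i => cls (letter i)) 5 (li5Tree s t) := by
  refine SLi5_eq_eval ?_ ?_ (cls_eq_lin letter_ne_zero hz) (cls_eq_lin letter_ne_zero hz')
  · rcases hz with h | h <;> simp [h, monomial_ne_zero letter_ne_zero]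
  · rcases hz' with h | h <;> simp [h, monomial_ne_zero letter_ne_zero]

theorem SI41_one_right {F : Type} [Field F] {v : ℕ → VF F} {x : F} (hx : cls x = lin v [1])
    (hx' : cls (1 - x) = lin v [0, 1]) : SI41 x 1 = eval v 5 (i41Tree [] [] [0, 1]) :=
  SI41_eq_eval hx hx' (by rw [cls_one, lin_nil]) (by rw [sub_self, cls_zero, lin_nil])
    (by rw [cls_sub_comm, hx'])

theorem Pit_smul_eval_threeTermTree :
    Pit 5 ((36 : ℚ)⁻¹ • eval (fun i => cls (letter i)) 5 threeTermTree) = 0 := by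
  rw [map_smul, ← eval_proj, eval_eq_zero_of_isZero _ _ _ isZero_proj_threeTermTree, smul_zero]

theorem threeTerm_eq_smul_sum {α M : Type*} [AddCommGroup M] [Module ℚ M] (f : α → M)
    (a1 a2 a3 a4 a5 a6 a7 b1 b2 b3 b4 b5 b6 b7 b8 b9
      b10 b11 b12 b13 b14 b15 b16 b17 b18 b19 b20 b21 b22 b23 : α) :
    (2 : ℚ)⁻¹ • (f a1 + f a2) + (2 : ℚ)⁻¹ • (f a3 + f a4) + (2 : ℚ)⁻¹ • (f a5 + f a6)
        - (2 : ℚ)⁻¹ • (f a7 + f a7)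
      - (- ((1 : ℚ) / 18) • -f b1 - ((1 : ℚ) / 18) • -f b2 - ((1 : ℚ) / 18) • -f b3
          + ((1 : ℚ) / 36) • -f b4 + ((1 : ℚ) / 36) • -f b5 + ((1 : ℚ) / 36) • -f b6
          + ((1 : ℚ) / 9) • -f b7
          + ((1 : ℚ) / 9) • -f b8 + ((1 : ℚ) / 9) • -f b9 - ((1 : ℚ) / 2) • -f b10
          - ((1 : ℚ) / 2) • -f b11
          - ((1 : ℚ) / 2) • -f b12 - ((1 : ℚ) / 2) • -f b13 - ((1 : ℚ) / 2) • -f b14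
          - ((1 : ℚ) / 2) • -f b15
          - ((5 : ℚ) / 4) • -f b16 - ((5 : ℚ) / 4) • -f b17 - ((5 : ℚ) / 4) • -f b18
          - ((5 : ℚ) / 4) • -f b19
          - ((5 : ℚ) / 4) • -f b20 - ((5 : ℚ) / 4) • -f b21 + -f b22 + ((3 : ℚ) / 2) • -f b23) =
      (36 : ℚ)⁻¹ • (([(18, a1), (18, a2), (18, a3), (18, a4), (18, a5), (18, a6),
          (-36, a7), (-2, b1), (-2, b2), (-2, b3), (1, b4), (1, b5),
          (1, b6), (4, b7), (4, b8), (4, b9), (-18, b10), (-18, b11),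
          (-18, b12), (-18, b13), (-18, b14), (-18, b15), (-45, b16), (-45, b17),
          (-45, b18), (-45, b19), (-45, b20), (-45, b21), (36, b22), (54, b23)] :
          List (ℤ × α)).map fun p => (p.1 : ℚ) • f p.2).sum := by
  simp only [List.map_cons, List.map_nil, List.sum_cons, List.sum_nil]
  push_cast
  module

theorem threeTerm_eq_smul_eval {F : Type} [Field F] (v : ℕ → VF F)
    (a1 a2 a3 a4 a5 a6 a7 b1 b2 b3 b4 b5 b6 b7 b8 b9
      b10 b11 b12 b13 b14 b15 b16 b17 b18 b19 b20 b21 b22 b23 : Tree 5) :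
    (2 : ℚ)⁻¹ • (eval v 5 a1 + eval v 5 a2) + (2 : ℚ)⁻¹ • (eval v 5 a3 + eval v 5 a4)
        + (2 : ℚ)⁻¹ • (eval v 5 a5 + eval v 5 a6)
        - (2 : ℚ)⁻¹ • (eval v 5 a7 + eval v 5 a7)
      - (- ((1 : ℚ) / 18) • -eval v 5 b1 - ((1 : ℚ) / 18) • -eval v 5 b2
          - ((1 : ℚ) / 18) • -eval v 5 b3
          + ((1 : ℚ) / 36) • -eval v 5 b4 + ((1 : ℚ) / 36) • -eval v 5 b5
          + ((1 : ℚ) / 36) • -eval v 5 b6 + ((1 : ℚ) / 9) • -eval v 5 b7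
          + ((1 : ℚ) / 9) • -eval v 5 b8 + ((1 : ℚ) / 9) • -eval v 5 b9
          - ((1 : ℚ) / 2) • -eval v 5 b10 - ((1 : ℚ) / 2) • -eval v 5 b11
          - ((1 : ℚ) / 2) • -eval v 5 b12 - ((1 : ℚ) / 2) • -eval v 5 b13
          - ((1 : ℚ) / 2) • -eval v 5 b14 - ((1 : ℚ) / 2) • -eval v 5 b15
          - ((5 : ℚ) / 4) • -eval v 5 b16 - ((5 : ℚ) / 4) • -eval v 5 b17
          - ((5 : ℚ) / 4) • -eval v 5 b18 - ((5 : ℚ) / 4) • -eval v 5 b19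
          - ((5 : ℚ) / 4) • -eval v 5 b20 - ((5 : ℚ) / 4) • -eval v 5 b21 + -eval v 5 b22
          + ((3 : ℚ) / 2) • -eval v 5 b23) =
      (36 : ℚ)⁻¹ • eval v 5 (Tree.weightedSum 5
        [(18, a1), (18, a2), (18, a3), (18, a4), (18, a5), (18, a6),
          (-36, a7), (-2, b1), (-2, b2), (-2, b3), (1, b4), (1, b5),
          (1, b6), (4, b7), (4, b8), (4, b9), (-18, b10), (-18, b11),
          (-18, b12), (-18, b13), (-18, b14), (-18, b15), (-45, b16), (-45, b17),
          (-45, b18), (-45, b19), (-45, b20), (-45, b21), (36, b22), (54, b23)]) := by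
  rw [eval_weightedSum]
  exact threeTerm_eq_smul_sum (eval v 5) ..

end GrassPoly


/-- the `Li₃` three-term identity for `I⁺_{4,1}` in the second argument. -/
theorem i41p_three_term :
    Pit 5 (I41p xx yy + I41p xx (1 - yy) + I41p xx (1 - yy⁻¹) - I41p xx 1) =
      Pit 5 (
        - ((1 : ℚ) / 18) • SLi5 ((1 - xx) * yy ^ 2 / (xx ^ 2 * (1 - yy)))
        - ((1 : ℚ) / 18) • SLi5 (xx ^ 2 * yy / ((1 - xx) * (1 - yy) ^ 2))
        - ((1 : ℚ) / 18) • SLi5 (xx ^ 2 * (1 - yy) * yy / (xx - 1))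
        + ((1 : ℚ) / 36) • SLi5 (xx * yy ^ 2 / ((1 - xx) ^ 2 * (1 - yy)))
        + ((1 : ℚ) / 36) • SLi5 ((1 - xx) ^ 2 * (yy - 1) * yy / xx)
        + ((1 : ℚ) / 36) • SLi5 ((1 - xx) ^ 2 * yy / (xx * (1 - yy) ^ 2))
        + ((1 : ℚ) / 9) • SLi5 ((xx - 1) * xx * yy ^ 2 / (1 - yy))
        + ((1 : ℚ) / 9) • SLi5 ((1 - yy) * yy / ((1 - xx) * xx))
        + ((1 : ℚ) / 9) • SLi5 (yy / ((xx - 1) * xx * (1 - yy) ^ 2))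
        - ((1 : ℚ) / 2) • SLi5 (((1 - xx) * (1 - yy))⁻¹)
        - ((1 : ℚ) / 2) • SLi5 ((1 - yy) / (1 - xx))
        - ((1 : ℚ) / 2) • SLi5 (yy / (1 - xx))
        - ((1 : ℚ) / 2) • SLi5 (-yy / ((1 - xx) * (1 - yy)))
        - ((1 : ℚ) / 2) • SLi5 ((1 - xx) * yy / (yy - 1))
        - ((1 : ℚ) / 2) • SLi5 ((1 - xx) * yy)
        - ((5 : ℚ) / 4) • SLi5 (xx / (1 - yy))
        - ((5 : ℚ) / 4) • SLi5 (xx * (1 - yy))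
        - ((5 : ℚ) / 4) • SLi5 (yy / xx)
        - ((5 : ℚ) / 4) • SLi5 (xx * yy)
        - ((5 : ℚ) / 4) • SLi5 (yy / (xx * (yy - 1)))
        - ((5 : ℚ) / 4) • SLi5 (xx * yy / (yy - 1))
        + SLi5 ((1 - xx)⁻¹)
        + ((3 : ℚ) / 2) • SLi5 xx) := by
  have hx : xx ≠ 0 := letter_ne_zero 0
  have hx' : 1 - xx ≠ 0 := letter_ne_zero 1
  have hy : yy ≠ 0 := letter_ne_zero 2
  have hy' : 1 - yy ≠ 0 := letter_ne_zero 3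
  have hx'' : xx - 1 ≠ 0 := sub_ne_zero.2 (sub_ne_zero.1 hx').symm
  have hy'' : yy - 1 ≠ 0 := sub_ne_zero.2 (sub_ne_zero.1 hy').symm
  have hy''' : 1 - yy⁻¹ ≠ 0 := by
    rw [sub_ne_zero, ne_comm, inv_ne_one]
    exact (sub_ne_zero.1 hy').symm
  have h1 : (1 : K2)⁻¹ = 1 := inv_one
  unfold I41p
  rw [h1,
    SI41_one_right (v := fun i => cls (letter i))
      (cls_eq_lin letter_ne_zero (.inl (by simp [monomial, letter])))
      (cls_eq_lin letter_ne_zero (.inl (by simp [monomial, letter]))),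
    SI41_eq_eval_letter (y := yy) [0, 0, 1] [0, 0, 0, 1] [0, 0, 0, 0, 1],
    SI41_eq_eval_letter (y := yy⁻¹) [0, 0, -1] [0, 0, -1, 1] [0, 0, -1, 0, 0, 1],
    SI41_eq_eval_letter (y := (1 - yy)) [0, 0, 0, 1] [0, 0, 1] [0, 0, 0, 0, 0, 0, 1],
    SI41_eq_eval_letter (y := (1 - yy)⁻¹) [0, 0, 0, -1] [0, 0, 1, -1] [0, 0, 0, -1, 0, 0, 0, 1],
    SI41_eq_eval_letter (y := (1 - yy⁻¹)) [0, 0, -1, 1] [0, 0, -1] [0, 0, -1, 0, 0, 0, 0, 0, 1],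
    SI41_eq_eval_letter (y := (1 - yy⁻¹)⁻¹)
      [0, 0, 1, -1] [0, 0, 0, -1] [0, 0, 0, -1, 0, 0, 0, 0, 0, 1],
    SLi5_eq_eval_letter (z := ((1 - xx) * yy ^ 2 / (xx ^ 2 * (1 - yy))))
      [-2, 1, 2, -1] [-2, 0, 0, -1, 1, 0, 0, 0, 0, 1],
    SLi5_eq_eval_letter (z := (xx ^ 2 * yy / ((1 - xx) * (1 - yy) ^ 2)))
      [2, -1, 1, -2] [0, -1, 0, -2, 0, 0, 1, 0, 1],
    SLi5_eq_eval_letter (z := (xx ^ 2 * (1 - yy) * yy / (xx - 1)))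
      [2, -1, 1, 1] [0, -1, 0, 0, 0, 1, 0, 1],
    SLi5_eq_eval_letter (z := (xx * yy ^ 2 / ((1 - xx) ^ 2 * (1 - yy))))
      [1, -2, 2, -1] [0, -2, 0, -1, 0, 0, 1, 1],
    SLi5_eq_eval_letter (z := ((1 - xx) ^ 2 * (yy - 1) * yy / xx))
      [-1, 2, 1, 1] [-1, 0, 0, 0, 0, 0, 0, 0, 1, 1],
    SLi5_eq_eval_letter (z := ((1 - xx) ^ 2 * yy / (xx * (1 - yy) ^ 2)))
      [-1, 2, 1, -2] [-1, 0, 0, -2, 1, 1],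
    SLi5_eq_eval_letter (z := ((xx - 1) * xx * yy ^ 2 / (1 - yy)))
      [1, 1, 2, -1] [0, 0, 0, -1, 0, 1, 0, 0, 1],
    SLi5_eq_eval_letter (z := ((1 - yy) * yy / ((1 - xx) * xx)))
      [-1, -1, 1, 1] [-1, -1, 0, 0, 1, 0, 1],
    SLi5_eq_eval_letter (z := (yy / ((xx - 1) * xx * (1 - yy) ^ 2)))
      [-1, -1, 1, -2] [-1, -1, 0, -2, 0, 0, 0, 1, 0, 1],
    SLi5_eq_eval_letter (z := (((1 - xx) * (1 - yy))⁻¹))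
      [0, -1, 0, -1] [0, -1, 0, -1, 0, 0, 0, 0, 0, 1],
    SLi5_eq_eval_letter (z := ((1 - yy) / (1 - xx))) [0, -1, 0, 1] [0, -1, 0, 0, 1],
    SLi5_eq_eval_letter (z := (yy / (1 - xx))) [0, -1, 1] [0, -1, 0, 0, 0, 0, 1],
    SLi5_eq_eval_letter (z := (-yy / ((1 - xx) * (1 - yy))))
      [0, -1, 1, -1] [0, -1, 0, -1, 0, 0, 0, 1],
    SLi5_eq_eval_letter (z := ((1 - xx) * yy / (yy - 1))) [0, 1, 1, -1] [0, 0, 0, -1, 0, 1],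
    SLi5_eq_eval_letter (z := ((1 - xx) * yy)) [0, 1, 1] [0, 0, 0, 0, 0, 0, 0, 0, 1],
    SLi5_eq_eval_letter (z := (xx / (1 - yy))) [1, 0, 0, -1] [0, 0, 0, -1, 0, 0, 1],
    SLi5_eq_eval_letter (z := (xx * (1 - yy))) [1, 0, 0, 1] [0, 0, 0, 0, 0, 0, 0, 1],
    SLi5_eq_eval_letter (z := (yy / xx)) [-1, 0, 1] [-1, 0, 0, 0, 1],
    SLi5_eq_eval_letter (z := (xx * yy)) [1, 0, 1] [0, 0, 0, 0, 0, 1],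
    SLi5_eq_eval_letter (z := (yy / (xx * (yy - 1))))
      [-1, 0, 1, -1] [-1, 0, 0, -1, 0, 0, 0, 0, 0, 1],
    SLi5_eq_eval_letter (z := (xx * yy / (yy - 1))) [1, 0, 1, -1] [0, 0, 0, -1, 0, 0, 0, 0, 1],
    SLi5_eq_eval_letter (z := ((1 - xx)⁻¹)) [0, -1] [1, -1],
    SLi5_eq_eval_letter (z := xx) [1] [0, 1]]
  · rw [← sub_eq_zero, ← map_sub]
    refine (congrArg (Pit 5) ?_).trans Pit_smul_eval_threeTermTree
    exact threeTerm_eq_smul_eval ..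
  all_goals
    simp only [monomial, letter, zpow_neg, zpow_zero, one_mul, mul_one]
    first
      | (left; field_simp; done)
      | (left; field_simp; ring1)
      | (right; field_simp; done)
      | (right; field_simp; ring1)
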